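/- Every almost zip commutative Bezout domain is an elementary divisor domain: every matrix over it admits diagonal reduction by invertible matrices, with each diagonal entry dividing the next. -/

import Mathlib

/-- A commutative ring is *zip* if every ideal with zero annihilator contains a
finitely generated subideal with zero annihilator. -/
def IsZipRing (R : Type*) [CommRing R] : Prop :=
  ∀ I : Ideal R, Submodule.annihilator I = ⊥ →
    ∃ I₀ : Ideal R, I₀ ≤ I ∧ I₀.FG ∧ Submodule.annihilator I₀ = ⊥

/-- An elementary divisor ring: every matrix admits diagonal reduction with each
diagonal entry dividing the next. -/
def IsElementaryDivisorRing (R : Type*) [CommRing R] : Prop :=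
  ∀ (n m : ℕ) (A : Matrix (Fin n) (Fin m) R),
    ∃ (P : Matrix (Fin n) (Fin n) R) (Q : Matrix (Fin m) (Fin m) R),
      IsUnit P ∧ IsUnit Q ∧
      (∀ (i : Fin n) (j : Fin m), (i : ℕ) ≠ (j : ℕ) → (P * A * Q) i j = 0) ∧
      (∀ (i : Fin n) (j : Fin m) (i' : Fin n) (j' : Fin m),
        (i : ℕ) = (j : ℕ) → (i' : ℕ) = (j' : ℕ) → (i : ℕ) + 1 = (i' : ℕ) →
          (P * A * Q) i j ∣ (P * A * Q) i' j')

/-- In a Bezout domain, two elements can be written as a common divisor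
times a pair of elements that generate the unit ideal. -/
theorem exists_eq_mul_coprime {R : Type*} [CommRing R] [IsDomain R] [IsBezout R] (a b : R) :
    ∃ g a' b' s t : R, a = g * a' ∧ b = g * b' ∧ s * a' + t * b' = 1 := by
  obtain ⟨g, hg⟩ := (IsBezout.span_pair_isPrincipal a b).principal
  have hg' : Ideal.span {a, b} = Ideal.span {g} := hg
  by_cases h0 : g = 0
  · have ha : a ∈ Ideal.span {g} := hg' ▸ Ideal.subset_span (by simp)
    have hb : b ∈ Ideal.span {g} := hg' ▸ Ideal.subset_span (by simp)
    rw [Ideal.mem_span_singleton, h0, zero_dvd_iff] at ha hb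
    exact ⟨0, 1, 0, 1, 0, by simp [ha], by simp [hb], by simp⟩
  · obtain ⟨a', ha⟩ := Ideal.mem_span_singleton.1
      (hg' ▸ Ideal.subset_span (by simp) : a ∈ Ideal.span {g})
    obtain ⟨b', hb⟩ := Ideal.mem_span_singleton.1
      (hg' ▸ Ideal.subset_span (by simp) : b ∈ Ideal.span {g})
    obtain ⟨s, t, hst⟩ := Ideal.mem_span_pair.1
      (hg' ▸ Ideal.mem_span_singleton_self g : g ∈ Ideal.span {a, b})
    refine ⟨g, a', b', s, t, ha, hb, mul_left_cancel₀ h0 ?_⟩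
    linear_combination hst - s * ha - t * hb

/-- In a reduced Bezout zip ring, two elements with zero product are separated by an
idempotent. -/
theorem IsZipRing.exists_idempotent_of_mul_eq_zero {S : Type*} [CommRing S] [IsReduced S]
    [IsBezout S] (hS : IsZipRing S) {a c : S} (hac : a * c = 0) :
    ∃ e : S, e * e = e ∧ c * e = c ∧ a * e = 0 := by
  obtain ⟨J, hJle, hJfg, hJ⟩ := hS (Ideal.span {c} ⊔ (Ideal.span {c}).annihilator) (by
    rw [eq_bot_iff]
    intro x hx
    rw [Submodule.mem_annihilator] at hx
    have hxc : x * c = 0 :=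
      hx c (Ideal.mem_sup_left (Ideal.mem_span_singleton_self c))
    have hxx : x * x = 0 := hx x (Ideal.mem_sup_right
      (by simpa [Submodule.mem_annihilator_span_singleton] using hxc))
    exact (Submodule.mem_bot S).2 (IsNilpotent.eq_zero ⟨2, by rw [pow_two, hxx]⟩))
  obtain ⟨s, hs⟩ := (IsBezout.isPrincipal_of_FG J hJfg).principal
  have hs' : J = Ideal.span {s} := hs
  have hsmem : s ∈ Ideal.span {c} ⊔ (Ideal.span {c}).annihilator :=
    hJle (hs' ▸ Ideal.mem_span_singleton_self s)
  obtain ⟨cu, hcu, v, hv, hsum⟩ := Submodule.mem_sup.1 hsmem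
  obtain ⟨u, rfl⟩ := Ideal.mem_span_singleton.1 hcu
  have hvc : v * c = 0 := by
    simpa using (Submodule.mem_annihilator.1 hv) c (Ideal.mem_span_singleton_self c)
  have hreg_s : ∀ x, x * s = 0 → x = 0 := by
    intro x hx
    have hmem : x ∈ J.annihilator := by
      rw [hs']
      simpa [Submodule.mem_annihilator_span_singleton] using hx
    simpa [hJ] using hmem
  obtain ⟨g, hg⟩ := (IsBezout.span_pair_isPrincipal c v).principal
  have hg' : Ideal.span {c, v} = Ideal.span {g} := hg
  obtain ⟨c', hc⟩ := Ideal.mem_span_singleton.1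
    (hg' ▸ Ideal.subset_span (by simp) : c ∈ Ideal.span {g})
  obtain ⟨v', hv'⟩ := Ideal.mem_span_singleton.1
    (hg' ▸ Ideal.subset_span (by simp) : v ∈ Ideal.span {g})
  obtain ⟨x, y, hxy⟩ := Ideal.mem_span_pair.1
    (hg' ▸ Ideal.mem_span_singleton_self g : g ∈ Ideal.span {c, v})
  have hreg : ∀ z, z * g = 0 → z = 0 := by
    intro z hz
    apply hreg_s
    rw [← hsum]
    linear_combination (c' * u + v') * hz + z * u * hc + z * hv'
  have hone : x * c' + y * v' = 1 := by
    refine sub_eq_zero.1 (hreg _ ?_)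
    linear_combination hxy - x * hc - y * hv'
  have hcv : c' * v' = 0 := by
    apply hreg
    apply hreg
    linear_combination hvc - v * hc - g * c' * hv'
  have hac' : a * c' = 0 := by
    apply hreg
    linear_combination hac - a * hc
  refine ⟨x * c', ?_, ?_, ?_⟩
  · linear_combination x * c' * hone - x * y * hcv
  · linear_combination (x * c' - 1) * hc + g * c' * hone - g * y * hcv
  · linear_combination x * hac'

/-- Comaximality of `x` and `y` lifts along the quotient by the radical of a multiple of `x`. -/
theorem exists_bezout_of_quotient_radical {R : Type*} [CommRing R] {x y m s t : R}
    (hm : x ∣ m)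
    (h : (Ideal.Quotient.mk (Ideal.span {m}).radical) (s * x + t * y) = 1) :
    ∃ s' t' : R, s' * x + t' * y = 1 := by
  have hmem : s * x + t * y - 1 ∈ (Ideal.span {m}).radical := by
    rw [← Ideal.Quotient.eq, h, map_one]
  obtain ⟨k, hk⟩ := hmem
  obtain ⟨l, hl⟩ := hm.trans (Ideal.mem_span_singleton.1 hk)
  have hdvd : s * x + t * y ∣ (s * x + t * y - 1) ^ k - (-1) ^ k := by
    have := sub_dvd_pow_sub_pow (s * x + t * y - 1) (-1) k
    simpa using this
  obtain ⟨r, hr⟩ := hdvd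
  have hsq : ((-1 : R) ^ k) * (-1) ^ k = 1 := by rw [← mul_pow]; simp
  refine ⟨(-1) ^ k * (l - r * s), (-1) ^ k * (-(r * t)), ?_⟩
  linear_combination (-1) ^ k * hr - (-1) ^ k * hl + hsq

/-- Kaplansky's condition holds in almost zip Bezout domains. -/
theorem kaplansky_condition_of_almost_zip {R : Type*} [CommRing R] [IsDomain R] [IsBezout R]
    (h : ∀ a : R, a ≠ 0 → ¬ IsUnit a →
      IsZipRing (R ⧸ (Ideal.span {a} : Ideal R).radical))
    {a b c x y z : R} (habc : x * a + y * b + z * c = 1) :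
    ∃ p q s t : R, s * (p * a) + t * (p * b + q * c) = 1 := by
  by_cases ha0 : a = 0
  · exact ⟨y, z, 0, 1, by linear_combination habc - x * ha0⟩
  by_cases hc0 : c = 0
  · exact ⟨1, 0, x, y, by linear_combination habc - z * hc0⟩
  by_cases hu : IsUnit (a * c)
  · obtain ⟨a', ha'⟩ := isUnit_iff_exists_inv.1 (isUnit_of_mul_isUnit_left hu)
    exact ⟨1, 0, a', 0, by linear_combination ha'⟩
  let I := (Ideal.span {a * c} : Ideal R).radical
  let π := Ideal.Quotient.mk I
  have hred : IsReduced (R ⧸ I) :=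
    (Ideal.isRadical_iff_quotient_reduced I).1 (Ideal.radical_isRadical _)
  have hbez : IsBezout (R ⧸ I) := Function.Surjective.isBezout π Ideal.Quotient.mk_surjective
  have hzip : IsZipRing (R ⧸ I) := h (a * c) (mul_ne_zero ha0 hc0) hu
  have hac : π a * π c = 0 := by
    rw [← map_mul]
    exact Ideal.Quotient.eq_zero_iff_mem.2 (Ideal.le_radical (Ideal.mem_span_singleton_self _))
  obtain ⟨e', hee, hce, hae⟩ := hzip.exists_idempotent_of_mul_eq_zero hac
  obtain ⟨e, rfl⟩ := Ideal.Quotient.mk_surjective e'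
  change π e * π e = π e at hee
  change π c * π e = π c at hce
  change π a * π e = 0 at hae
  have habc' : π x * π a + π y * π b + π z * π c = 1 := by
    rw [← map_mul, ← map_mul, ← map_mul, ← map_add, ← map_add, habc, map_one]
  let p := (1 - e) + e * y
  let q := e * z
  obtain ⟨s₁, t₁, h₁⟩ : ∃ s t : R, s * c + t * p = 1 := by
    refine exists_bezout_of_quotient_radical (m := a * c) (s := e * z)
      (t := (1 - e) + e * b) (Dvd.intro_left a rfl) ?_
    change π (e * z * c + ((1 - e) + e * b) * ((1 - e) + e * y)) = 1
    simp only [map_add, map_mul, map_sub, map_one]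
    linear_combination π e * habc' - π x * hae + (1 - π b - π y + π b * π y) * hee
  obtain ⟨s₂, t₂, h₂⟩ : ∃ s t : R, s * a + t * (p * b + q * c) = 1 := by
    refine exists_bezout_of_quotient_radical (m := a * c) (s := (1 - e) * x)
      (t := (1 - e) * y + e) (Dvd.intro c rfl) ?_
    change π ((1 - e) * x * a + ((1 - e) * y + e) * (((1 - e) + e * y) * b + e * z * c)) = 1
    simp only [map_add, map_mul, map_sub, map_one]
    have hw : π e * (π y * π b + π z * π c) = π e := by
      linear_combination π e * habc' - π x * hae
    linear_combination habc' - π x * hae + ((1 - π e) * π y + π e - 1) * hw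
      + (- π y + π y * π b - π b + 1) * hee + π z * hce
  obtain ⟨g, p', q', u, v, hp, hq, huv⟩ := exists_eq_mul_coprime p q
  have hpc : s₁ * c + t₁ * g * p' = 1 := by linear_combination h₁ - t₁ * hp
  have ha : s₂ * a + t₂ * g * (p' * b + q' * c) = 1 := by
    linear_combination h₂ - t₂ * b * hp - t₂ * c * hq
  obtain ⟨s₃, t₃, h₃⟩ : ∃ s t : R, s * p' + t * (p' * b + q' * c) = 1 := by
    have hcop : IsCoprime p' (q' * c) :=
      IsCoprime.mul_right ⟨u, v, huv⟩ ⟨t₁ * g, s₁, by linear_combination hpc⟩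
    obtain ⟨s, t, hst⟩ := hcop
    exact ⟨s - t * b, t, by linear_combination hst⟩
  obtain ⟨s, t, hst⟩ : IsCoprime (p' * a) (p' * b + q' * c) :=
    IsCoprime.mul_left ⟨s₃, t₃, h₃⟩ ⟨s₂, t₂ * g, ha⟩
  exact ⟨p', q', s, t, hst⟩

/-- The bilinear form of any `2 × 2` matrix takes a value that divides all entries. -/
def HasDividingValue (R : Type*) [CommRing R] : Prop :=
  ∀ α β γ δ : R, ∃ p q s t : R,
    p * (α * s + β * t) + q * (γ * s + δ * t) ∣ α ∧
    p * (α * s + β * t) + q * (γ * s + δ * t) ∣ β ∧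
    p * (α * s + β * t) + q * (γ * s + δ * t) ∣ γ ∧
    p * (α * s + β * t) + q * (γ * s + δ * t) ∣ δ

theorem hasDividingValue_of_almost_zip {R : Type*} [CommRing R] [IsDomain R] [IsBezout R]
    (h : ∀ a : R, a ≠ 0 → ¬ IsUnit a →
      IsZipRing (R ⧸ (Ideal.span {a} : Ideal R).radical)) :
    HasDividingValue R := by
  intro α β γ δ
  obtain ⟨g, γ', δ', s, t, hγ, hδ, hst⟩ := exists_eq_mul_coprime γ δ
  let a := δ' * α - γ' * β
  let b := s * α + t * β
  obtain ⟨k, b', c', u, v, hb, hc, huv⟩ := exists_eq_mul_coprime b g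
  obtain ⟨d, a', k', x, y, ha, hk, hxy⟩ := exists_eq_mul_coprime a k
  obtain ⟨p, q, m, n, hpq⟩ := kaplansky_condition_of_almost_zip h
    (a := a') (b := k' * b') (c := k' * c') (x := x) (y := y * u) (z := y * v)
    (by linear_combination hxy + y * k' * huv)
  have hα : α = t * a + γ' * b := by
    simp only [a, b]
    linear_combination -α * hst
  have hβ : β = -s * a + δ' * b := by
    simp only [a, b]
    linear_combination -β * hst
  have hval : p * (α * (m * δ' + n * s) + β * (n * t - m * γ')) +
      q * (γ * (m * δ' + n * s) + δ * (n * t - m * γ')) = d := by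
    have hab : p * (α * (m * δ' + n * s) + β * (n * t - m * γ')) = p * (m * a + n * b) := by
      simp only [a, b]
      ring
    rw [hab, hγ, hδ]
    linear_combination d * hpq + p * m * ha + p * n * hb + p * n * b' * hk
      + q * n * g * hst + q * n * hc + q * n * c' * hk
  have hda : d ∣ a := ⟨a', ha⟩
  have hdb : d ∣ b := (Dvd.intro k' hk.symm).trans ⟨b', hb⟩
  have hdg : d ∣ g := (Dvd.intro k' hk.symm).trans ⟨c', hc⟩
  refine ⟨p, q, m * δ' + n * s, n * t - m * γ', ?_⟩
  rw [hval]
  refine ⟨?_, ?_, hdg.trans ⟨_, hγ⟩, hdg.trans ⟨_, hδ⟩⟩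
  · rw [hα]
    exact dvd_add (hda.mul_left _) (hdb.mul_left _)
  · rw [hβ]
    exact dvd_add (hda.mul_left _) (hdb.mul_left _)

section BilinearForm

variable {R M N : Type*} [CommRing R] [AddCommGroup M] [Module R M] [AddCommGroup N] [Module R N]

theorem HasDividingValue.exists_mem_span_pair (hR : HasDividingValue R) (B : M →ₗ[R] N →ₗ[R] R)
    (x₁ x₂ : M) (y₁ y₂ : N) :
    ∃ x ∈ Submodule.span R {x₁, x₂}, ∃ y ∈ Submodule.span R {y₁, y₂},
      ∀ x' ∈ Submodule.span R {x₁, x₂}, ∀ y' ∈ Submodule.span R {y₁, y₂}, B x y ∣ B x' y' := by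
  obtain ⟨p, q, s, t, h₁, h₂, h₃, h₄⟩ := hR (B x₁ y₁) (B x₁ y₂) (B x₂ y₁) (B x₂ y₂)
  refine ⟨p • x₁ + q • x₂, Submodule.mem_span_pair.2 ⟨p, q, rfl⟩, s • y₁ + t • y₂,
    Submodule.mem_span_pair.2 ⟨s, t, rfl⟩, ?_⟩
  intro x' hx' y' hy'
  obtain ⟨p', q', rfl⟩ := Submodule.mem_span_pair.1 hx'
  obtain ⟨s', t', rfl⟩ := Submodule.mem_span_pair.1 hy'
  have hval : B (p • x₁ + q • x₂) (s • y₁ + t • y₂) =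
      p * (B x₁ y₁ * s + B x₁ y₂ * t) + q * (B x₂ y₁ * s + B x₂ y₂ * t) := by
    simp only [map_add, map_smul, LinearMap.add_apply, LinearMap.smul_apply, smul_eq_mul]
    ring
  rw [hval]
  simp only [map_add, map_smul, LinearMap.add_apply, LinearMap.smul_apply, smul_eq_mul]
  exact dvd_add ((dvd_add (h₁.mul_left _) (h₃.mul_left _)).mul_left _)
    ((dvd_add (h₂.mul_left _) (h₄.mul_left _)).mul_left _)

theorem HasDividingValue.exists_mem_span_pair_of_fg (hR : HasDividingValue R)
    (B : M →ₗ[R] N →ₗ[R] R) (x₁ x₂ : M) {N' : Submodule R N} (hN : N'.FG) :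
    ∃ x ∈ Submodule.span R {x₁, x₂}, ∃ y ∈ N',
      ∀ x' ∈ Submodule.span R {x₁, x₂}, ∀ y' ∈ N', B x y ∣ B x' y' := by
  induction N', hN using Submodule.fg_induction with
  | singleton y => simpa using hR.exists_mem_span_pair B x₁ x₂ y y
  | sup N₁ N₂ _ _ h₁ h₂ =>
    obtain ⟨u₁, hu₁, v₁, hv₁, hd₁⟩ := h₁
    obtain ⟨u₂, hu₂, v₂, hv₂, hd₂⟩ := h₂
    obtain ⟨x, hx, y, hy, hd⟩ := hR.exists_mem_span_pair B x₁ x₂ v₁ v₂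
    refine ⟨x, hx, y, ?_, ?_⟩
    · refine (Submodule.span_le.2 ?_ : Submodule.span R {v₁, v₂} ≤ N₁ ⊔ N₂) hy
      rintro w (rfl | rfl)
      · exact Submodule.mem_sup_left hv₁
      · exact Submodule.mem_sup_right hv₂
    · intro x' hx' y' hy'
      obtain ⟨w₁, hw₁, w₂, hw₂, rfl⟩ := Submodule.mem_sup.1 hy'
      rw [map_add]
      exact dvd_add
        ((hd u₁ hu₁ v₁ (Submodule.subset_span (by simp))).trans (hd₁ x' hx' w₁ hw₁))
        ((hd u₂ hu₂ v₂ (Submodule.subset_span (by simp))).trans (hd₂ x' hx' w₂ hw₂))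

theorem HasDividingValue.exists_of_fg (hR : HasDividingValue R)
    (B : M →ₗ[R] N →ₗ[R] R) {M' : Submodule R M} {N' : Submodule R N} (hM : M'.FG)
    (hN : N'.FG) :
    ∃ x ∈ M', ∃ y ∈ N', ∀ x' ∈ M', ∀ y' ∈ N', B x y ∣ B x' y' := by
  induction M', hM using Submodule.fg_induction with
  | singleton x => simpa using hR.exists_mem_span_pair_of_fg B x x hN
  | sup M₁ M₂ _ _ h₁ h₂ =>
    obtain ⟨u₁, hu₁, v₁, hv₁, hd₁⟩ := h₁
    obtain ⟨u₂, hu₂, v₂, hv₂, hd₂⟩ := h₂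
    obtain ⟨x, hx, y, hy, hd⟩ := hR.exists_mem_span_pair_of_fg B u₁ u₂ hN
    refine ⟨x, ?_, y, hy, ?_⟩
    · refine (Submodule.span_le.2 ?_ : Submodule.span R {u₁, u₂} ≤ M₁ ⊔ M₂) hx
      rintro w (rfl | rfl)
      · exact Submodule.mem_sup_left hu₁
      · exact Submodule.mem_sup_right hu₂
    · intro x' hx' y' hy'
      obtain ⟨w₁, hw₁, w₂, hw₂, rfl⟩ := Submodule.mem_sup.1 hx'
      rw [map_add, LinearMap.add_apply]
      exact dvd_add
        ((hd u₁ (Submodule.subset_span (by simp)) v₁ hv₁).trans (hd₁ w₁ hw₁ y' hy'))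
        ((hd u₂ (Submodule.subset_span (by simp)) v₂ hv₂).trans (hd₂ w₂ hw₂ y' hy'))

end BilinearForm

open Matrix

theorem HasDividingValue.exists_dotProduct_dvd {R : Type*} [CommRing R]
    (hR : HasDividingValue R) {m n : ℕ} (A : Matrix (Fin n) (Fin m) R) :
    ∃ (x : Fin n → R) (y : Fin m → R), ∀ i j, x ⬝ᵥ A *ᵥ y ∣ A i j := by
  obtain ⟨x, -, y, -, hxy⟩ := hR.exists_of_fg (Matrix.toLinearMap₂' R A)
    (Module.Finite.fg_top (R := R) (M := Fin n → R))
    (Module.Finite.fg_top (R := R) (M := Fin m → R))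
  refine ⟨x, y, fun i j => ?_⟩
  simpa [Matrix.toLinearMap₂'_apply'] using
    hxy (Pi.single i 1) trivial (Pi.single j 1) trivial

/-- The linear automorphism acting on the coordinates `i` and `j` by a `2 × 2` matrix of
determinant one. -/
def coordinatePairEquiv {R ι : Type*} [CommRing R] [DecidableEq ι] {i j : ι} (hij : i ≠ j)
    {s t u w : R} (hdet : s * w - t * u = 1) : (ι → R) ≃ₗ[R] (ι → R) where
  toFun f := fun k => if k = i then s * f i + t * f j else if k = j then u * f i + w * f j else f k
  invFun f := fun k =>
    if k = i then w * f i - t * f j else if k = j then s * f j - u * f i else f k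
  map_add' f g := by
    ext k
    simp only [Pi.add_apply]
    split_ifs <;> ring
  map_smul' r f := by
    ext k
    simp only [Pi.smul_apply, smul_eq_mul, RingHom.id_apply]
    split_ifs <;> ring
  left_inv f := by
    ext k
    simp only [if_true, if_neg hij.symm]
    split_ifs with h₁ h₂
    · subst h₁
      linear_combination f k * hdet
    · subst h₂
      linear_combination f k * hdet
    · rfl
  right_inv f := by
    ext k
    simp only [if_true, if_neg hij.symm]
    split_ifs with h₁ h₂
    · subst h₁
      linear_combination f k * hdet
    · subst h₂
      linear_combination f k * hdet
    · rfl

theorem exists_linearEquiv_apply_eq_zero {R ι : Type*} [CommRing R] [IsDomain R] [IsBezout R]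
    [DecidableEq ι] (i : ι) (v : ι → R) (s : Finset ι) (hs : i ∉ s) :
    ∃ e : (ι → R) ≃ₗ[R] (ι → R), ∀ k ∈ s, e v k = 0 := by
  induction s using Finset.induction_on with
  | empty => exact ⟨LinearEquiv.refl R _, by simp⟩
  | insert j s hj ih =>
    rw [Finset.mem_insert, not_or] at hs
    obtain ⟨e, he⟩ := ih hs.2
    obtain ⟨g, a, b, x, y, ha, hb, hxy⟩ := exists_eq_mul_coprime (e v i) (e v j)
    refine ⟨e.trans (coordinatePairEquiv hs.1 (s := x) (t := y) (u := -b) (w := a)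
      (by linear_combination hxy)), fun k hk => ?_⟩
    rw [Finset.mem_insert] at hk
    simp only [LinearEquiv.trans_apply, coordinatePairEquiv, LinearEquiv.coe_mk,
      LinearMap.coe_mk, AddHom.coe_mk]
    rcases hk with rfl | hk
    · rw [if_neg (Ne.symm hs.1), if_pos rfl]
      linear_combination a * hb - b * ha
    · rw [if_neg (ne_of_mem_of_not_mem hk hs.2), if_neg (ne_of_mem_of_not_mem hk hj)]
      exact he k hk

/-- Over a Bezout domain, unimodular columns can be moved to a standard basis vector. -/
theorem exists_isUnit_mulVec_eq_single {R ι : Type*} [CommRing R] [IsDomain R] [IsBezout R]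
    [Fintype ι] [DecidableEq ι] (i : ι) {x v : ι → R} (hxv : x ⬝ᵥ v = 1) :
    ∃ P : Matrix ι ι R, IsUnit P ∧ P *ᵥ v = Pi.single i 1 := by
  obtain ⟨e, he⟩ := exists_linearEquiv_apply_eq_zero i v (Finset.univ.erase i) (by simp)
  have hev : e v = e v i • Pi.single i (1 : R) := by
    ext k
    by_cases hk : k = i
    · subst hk
      simp
    · simp [hk, he k (by simp [hk])]
  have hunit : e v i * (x ⬝ᵥ e.symm (Pi.single i 1)) = 1 := by
    rw [← smul_eq_mul, ← dotProduct_smul, ← map_smul, ← hev, e.symm_apply_apply, hxv]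
  set r := x ⬝ᵥ e.symm (Pi.single i 1)
  refine ⟨r • LinearMap.toMatrix' (e : (ι → R) →ₗ[R] (ι → R)), ?_, ?_⟩
  · refine IsUnit.of_mul_eq_one
      (e v i • LinearMap.toMatrix' (e.symm : (ι → R) →ₗ[R] (ι → R))) ?_
    rw [smul_mul_smul_comm, mul_comm r, hunit, ← LinearMap.toMatrix'_comp]
    simp
  · rw [Matrix.smul_mulVec, LinearMap.toMatrix'_mulVec]
    change r • e v = _
    rw [hev, smul_smul, mul_comm, hunit, one_smul]

/-- The matrix with corner `d`, the rest of its first row `r`, the rest of its first column zero,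
and complementary block `C`. -/
def cornerBlock {R : Type*} [Zero R] {n m : ℕ} (d : R) (r : Fin m → R)
    (C : Matrix (Fin n) (Fin m) R) : Matrix (Fin (n + 1)) (Fin (m + 1)) R :=
  Matrix.of (Fin.cons (Fin.cons d r) fun i => Fin.cons 0 (C i))

section CornerBlock

variable {R : Type*} [CommRing R] {l m n : ℕ}

theorem cornerBlock_mul (d d' : R) (r : Fin m → R) (r' : Fin l → R)
    (C : Matrix (Fin n) (Fin m) R) (C' : Matrix (Fin m) (Fin l) R) :
    cornerBlock d r C * cornerBlock d' r' C' = cornerBlock (d * d') (d • r' + r ᵥ* C') (C * C') := by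
  ext i j
  refine Fin.cases ?_ (fun i => ?_) i <;> refine Fin.cases ?_ (fun j => ?_) j <;>
    simp [cornerBlock, Matrix.mul_apply, Fin.sum_univ_succ, Matrix.vecMul, dotProduct]

theorem cornerBlock_one : cornerBlock (1 : R) 0 (1 : Matrix (Fin n) (Fin n) R) = 1 := by
  ext i j
  refine Fin.cases ?_ (fun i => ?_) i <;> refine Fin.cases ?_ (fun j => ?_) j <;>
    simp [cornerBlock, Matrix.one_apply, Fin.succ_ne_zero, (Fin.succ_ne_zero _).symm]

theorem isUnit_cornerBlock (r : Fin n → R) {P : Matrix (Fin n) (Fin n) R} (hP : IsUnit P) :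
    IsUnit (cornerBlock 1 r P) := by
  obtain ⟨P, rfl⟩ := hP
  refine IsUnit.of_mul_eq_one (cornerBlock 1 (-(r ᵥ* (↑P⁻¹ : Matrix (Fin n) (Fin n) R))) ↑P⁻¹) ?_
  rw [cornerBlock_mul, ← cornerBlock_one]
  simp

end CornerBlock

theorem HasDividingValue.exists_cornerBlock {R : Type*} [CommRing R] [IsDomain R] [IsBezout R]
    (hR : HasDividingValue R) {n m : ℕ} (A : Matrix (Fin (n + 1)) (Fin (m + 1)) R) :
    ∃ (P : Matrix (Fin (n + 1)) (Fin (n + 1)) R) (Q : Matrix (Fin (m + 1)) (Fin (m + 1)) R)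
      (d : R) (C : Matrix (Fin n) (Fin m) R), IsUnit P ∧ IsUnit Q ∧
      P * A * Q = cornerBlock d 0 (d • C) := by
  obtain ⟨x, y, hxy⟩ := hR.exists_dotProduct_dvd A
  set d := x ⬝ᵥ A *ᵥ y
  choose A' hA' using hxy
  have hA : A = d • Matrix.of A' := by
    ext i j
    simpa using hA' i j
  by_cases hd0 : d = 0
  · refine ⟨1, 1, 0, 0, isUnit_one, isUnit_one, ?_⟩
    rw [hA, hd0]
    ext i j
    refine Fin.cases ?_ (fun i => ?_) i <;> refine Fin.cases ?_ (fun j => ?_) j <;>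
      simp [cornerBlock]
  have hone : x ⬝ᵥ Matrix.of A' *ᵥ y = 1 := by
    refine mul_left_cancel₀ hd0 ?_
    rw [mul_one, ← smul_eq_mul, ← dotProduct_smul, ← Matrix.smul_mulVec, ← hA]
  obtain ⟨P, hP, hPw⟩ := exists_isUnit_mulVec_eq_single 0 hone
  rw [Matrix.dotProduct_mulVec] at hone
  obtain ⟨Q, hQ, hQy⟩ := exists_isUnit_mulVec_eq_single 0 hone
  obtain ⟨Q, rfl⟩ := hQ
  set T := P * Matrix.of A' * (↑Q⁻¹ : Matrix (Fin (m + 1)) (Fin (m + 1)) R) with hT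
  have hcol : T *ᵥ Pi.single 0 1 = Pi.single 0 1 := by
    rw [hT, ← hQy, Matrix.mulVec_mulVec, Matrix.mul_assoc, Units.inv_mul, Matrix.mul_one,
      ← Matrix.mulVec_mulVec, hPw]
  rw [Matrix.mulVec_single_one] at hcol
  have hcol' : ∀ i, T i 0 = Pi.single (M := fun _ => R) 0 1 i := fun i => congrFun hcol i
  obtain ⟨r, C, hblock⟩ : ∃ (r : Fin m → R) (C : Matrix (Fin n) (Fin m) R),
      T = cornerBlock 1 r C := by
    refine ⟨fun j => T 0 j.succ, Matrix.of fun i j => T i.succ j.succ, ?_⟩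
    ext i j
    refine Fin.cases ?_ (fun i => ?_) i <;> refine Fin.cases ?_ (fun j => ?_) j <;>
      simp [cornerBlock, hcol']
  let E : Matrix (Fin (m + 1)) (Fin (m + 1)) R := cornerBlock 1 (-r) 1
  refine ⟨P, Q⁻¹.val * E, d, C, hP, Q⁻¹.isUnit.mul (isUnit_cornerBlock _ isUnit_one), ?_⟩
  have hmul : P * A * (Q⁻¹.val * E) = d • (T * E) := by
    rw [hA, hT]
    simp only [Matrix.mul_smul, Matrix.smul_mul, Matrix.mul_assoc]
  rw [hmul, hblock, cornerBlock_mul]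
  ext i j
  refine Fin.cases ?_ (fun i => ?_) i <;> refine Fin.cases ?_ (fun j => ?_) j <;>
    simp [cornerBlock]

theorem HasDividingValue.isElementaryDivisorRing {R : Type*} [CommRing R] [IsDomain R]
    [IsBezout R] (hR : HasDividingValue R) : IsElementaryDivisorRing R := by
  intro n
  induction n with
  | zero => exact fun m A => ⟨1, 1, isUnit_one, isUnit_one, fun i => i.elim0, fun i => i.elim0⟩
  | succ n ih =>
    rintro (_ | m) A
    · exact ⟨1, 1, isUnit_one, isUnit_one, fun _ j => j.elim0, fun _ j => j.elim0⟩
    obtain ⟨P, Q, d, C, hP, hQ, hPQ⟩ := hR.exists_cornerBlock A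
    obtain ⟨P', Q', hP', hQ', hdiag, hdvd⟩ := ih m (d • C)
    have hprod : cornerBlock 1 0 P' * P * A * (Q * cornerBlock 1 0 Q') =
        cornerBlock d 0 (P' * (d • C) * Q') := by
      rw [Matrix.mul_assoc, Matrix.mul_assoc, ← Matrix.mul_assoc A, ← Matrix.mul_assoc P,
        ← Matrix.mul_assoc P, hPQ, cornerBlock_mul, cornerBlock_mul]
      simp [Matrix.mul_assoc]
    refine ⟨cornerBlock 1 0 P' * P, Q * cornerBlock 1 0 Q',
      (isUnit_cornerBlock 0 hP').mul hP, hQ.mul (isUnit_cornerBlock 0 hQ'), ?_, ?_⟩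
    · rw [hprod]
      intro i j
      refine Fin.cases ?_ (fun i => ?_) i <;> refine Fin.cases ?_ (fun j => ?_) j
      · simp
      · simp [cornerBlock]
      · simp [cornerBlock]
      · intro hij
        simpa [cornerBlock] using hdiag i j (by simpa using hij)
    · rw [hprod]
      intro i j i' j' hij hij' hsucc
      obtain ⟨i', rfl⟩ := Fin.exists_succ_eq.2 (show i' ≠ 0 by rintro rfl; simp at hsucc)
      obtain ⟨j', rfl⟩ := Fin.exists_succ_eq.2 (show j' ≠ 0 by rintro rfl; simp at hij')
      revert hij hsucc
      refine Fin.cases ?_ (fun i => ?_) i <;> refine Fin.cases ?_ (fun j => ?_) j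
      · intro _ _
        change d ∣ (P' * (d • C) * Q') i' j'
        rw [Matrix.mul_smul, Matrix.smul_mul]
        exact Dvd.intro _ rfl
      · intro hij
        simp at hij
      · intro hij
        simp at hij
      · intro hij hsucc
        exact hdvd i j i' j' (by simpa using hij) (by simpa using hij') (by simpa using hsucc)

/-- Every almost zip commutative Bezout domain is an elementary
divisor domain. -/
theorem elementaryDivisor_of_almost_zip (R : Type*) [CommRing R] [IsDomain R] [IsBezout R]
    (h : ∀ a : R, a ≠ 0 → ¬ IsUnit a →
      IsZipRing (R ⧸ (Ideal.span {a} : Ideal R).radical)) :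
    IsElementaryDivisorRing R :=
  (hasDividingValue_of_almost_zip h).isElementaryDivisorRing
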